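/- Let V_1,...,V_r be subspaces of a finite-dimensional vector space E over a field forming a representation of a discrete polymatroid D, i.e. dim(∑_{i∈X} V_i) = ρ(X) for all X ⊆ {1,...,r}, where ρ is the rank function of D. If b is a basis vector of D with components b_i, then there exist subspaces V'_i ⊆ V_i for each i ∈ supp(b) such that dim(V'_i) = b_i and dim(∑_{i∈supp(b)} V'_i) = rank(D). -/

import Mathlib

open scoped Classical


/-- Sum of the components of `u` indexed by the elements of `A`. -/
noncomputable def setSum {r : ℕ} (u : Fin r → ℕ) (A : Set (Fin r)) : ℕ :=
  ∑ i ∈ Finset.univ.filter (· ∈ A), u i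

/-- A discrete polymatroid on the ground set `{1,…,r}` (modelled as `Fin r`). -/
structure DiscretePolymatroid (r : ℕ) where
  carrier : Set (Fin r → ℕ)
  nonempty : carrier.Nonempty
  finite : carrier.Finite
  lower : ∀ u ∈ carrier, ∀ v : Fin r → ℕ, (∀ i, v i ≤ u i) → v ∈ carrier
  exchange : ∀ u ∈ carrier, ∀ v ∈ carrier, (∑ i, u i) < (∑ i, v i) →
    ∃ w ∈ carrier, (∀ i, u i ≤ w i) ∧ u ≠ w ∧ ∀ i, w i ≤ max (u i) (v i)

namespace DiscretePolymatroid

variable {r : ℕ} (D : DiscretePolymatroid r)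

/-- The rank function of a discrete polymatroid. -/
noncomputable def rho (A : Set (Fin r)) : ℕ :=
  D.finite.toFinset.sup fun u => setSum u A

/-- `ρ_max(D) = max_i ρ({i})`. -/
noncomputable def rhoMax : ℕ := Finset.univ.sup fun i : Fin r => D.rho {i}

/-- The rank of the discrete polymatroid (the common component sum of its basis vectors). -/
noncomputable def rank : ℕ := D.rho Set.univ

end DiscretePolymatroid

/-- The subspaces `V i` of `F^d` represent the rank function `ρ'` when
`dim (∑_{i ∈ X} V i) = ρ'(X)` for every `X`. -/
def RepFnOver (r : ℕ) (ρ' : Set (Fin r) → ℕ) (F : Type) [Field F] : Prop :=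
  ∃ (d : ℕ) (V : Fin r → Submodule F (Fin d → F)),
    ∀ X : Set (Fin r), Module.finrank F ↥(⨆ i ∈ X, V i) = ρ' X

/-- A discrete polymatroid is representable over `F` if its rank function is. -/
def DiscretePolymatroid.RepresentableOver {r : ℕ} (D : DiscretePolymatroid r)
    (F : Type) [Field F] : Prop :=
  RepFnOver r D.rho F

/-- `b` is a maximal element (basis vector) of the set of vectors `S`. -/
def IsBasisOf {r : ℕ} (S : Set (Fin r → ℕ)) (b : Fin r → ℕ) : Prop :=
  b ∈ S ∧ ∀ u ∈ S, (∀ i, b i ≤ u i) → u = b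

/-- **Rado's theorem for subspaces.** If any `k` of the finitely many subspaces `U i` span a subspace
of dimension at least `k`, then there is a linearly independent family of vectors `w i ∈ U i`. -/
theorem exists_linearIndependent_of_card_le_finrank_sup {ι K W : Type*} [Fintype ι] [Field K]
    [AddCommGroup W] [Module K W] [FiniteDimensional K W] (U : ι → Submodule K W)
    (hU : ∀ X : Finset ι, X.card ≤ Module.finrank K ↥(X.sup U)) :
    ∃ w : ι → W, (∀ i, w i ∈ U i) ∧ LinearIndependent K w := by
  induction hn : ∑ i, Module.finrank K ↥(U i) using Nat.strong_induction_on generalizing U with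
  | _ n ih =>
  subst hn
  have hne : ∀ i, ∃ v ∈ U i, v ≠ 0 := fun i => by
    refine Submodule.exists_mem_ne_zero_of_ne_bot fun h => ?_
    have := hU {i}
    simp [h] at this
  choose v hvU hv0 using hne
  by_cases hspan : ∀ i, U i = K ∙ v i
  · refine ⟨v, hvU, linearIndependent_iff_card_le_finrank_span.2 ?_⟩
    have hsup : Finset.univ.sup U = Submodule.span K (Set.range v) := by
      rw [Submodule.span_range_eq_iSup, Finset.sup_univ_eq_iSup]
      exact iSup_congr hspan
    have h := hU Finset.univ
    rwa [hsup] at h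
  push Not at hspan
  obtain ⟨i, hi⟩ := hspan
  have hle : K ∙ v i ≤ U i := (Submodule.span_singleton_le_iff_mem _ _).2 (hvU i)
  obtain ⟨C, hC⟩ := Submodule.exists_isCompl (K ∙ v i)
  have hsup : K ∙ v i ⊔ C ⊓ U i = U i := by
    rw [← sup_inf_assoc_of_le C hle, hC.sup_eq_top, top_inf_eq]
  have hlt : C ⊓ U i < U i := by
    refine lt_of_le_of_ne inf_le_right fun h => hv0 i ?_
    exact Submodule.disjoint_def.1 hC.disjoint _ (Submodule.mem_span_singleton_self _)
      (inf_eq_right.1 h (hvU i))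
  -- A proper subspace of `U i` either keeps the hypothesis or violates it on a set through `i`.
  have step : ∀ H < U i, (∃ w : ι → W, (∀ i, w i ∈ U i) ∧ LinearIndependent K w) ∨
      ∃ Y : Finset ι, i ∉ Y ∧ Module.finrank K ↥(H ⊔ Y.sup U) ≤ Y.card := by
    intro H hH
    have hoff : ∀ Y : Finset ι, i ∉ Y → Y.sup (Function.update U i H) = Y.sup U := fun Y hY =>
      Finset.sup_congr rfl fun j hj =>
        Function.update_of_ne (ne_of_mem_of_not_mem hj hY) _ _
    by_cases hgood : ∀ X : Finset ι, X.card ≤ Module.finrank K ↥(X.sup (Function.update U i H))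
    · left
      have hmono : ∀ j, Function.update U i H j ≤ U j := fun j => by
        rcases eq_or_ne j i with rfl | hj
        · simpa using hH.le
        · simp [hj]
      obtain ⟨w, hw, hwi⟩ := ih _ (Finset.sum_lt_sum
        (fun j _ => Submodule.finrank_mono (hmono j))
        ⟨i, Finset.mem_univ i, by rw [Function.update_self]; exact Submodule.finrank_lt_finrank_of_lt hH⟩) _ hgood rfl
      exact ⟨w, fun j => hmono j (hw j), hwi⟩
    · right
      push Not at hgood
      obtain ⟨X, hX⟩ := hgood
      by_cases hiX : i ∈ X
      · refine ⟨X.erase i, Finset.notMem_erase i X, ?_⟩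
        rw [← Finset.insert_erase hiX, Finset.sup_insert, hoff _ (Finset.notMem_erase i X),
          Function.update_self, Finset.card_insert_of_notMem (Finset.notMem_erase i X)] at hX
        omega
      · rw [hoff X hiX] at hX
        exact absurd (hU X) (not_le.2 hX)
  obtain h | ⟨Y₁, hi₁, h₁⟩ := step _ (lt_of_le_of_ne hle hi.symm)
  · exact h
  obtain h | ⟨Y₂, hi₂, h₂⟩ := step _ hlt
  · exact h
  exfalso
  have hunion : (insert i (Y₁ ∪ Y₂)).sup U ≤ (K ∙ v i ⊔ Y₁.sup U) ⊔ (C ⊓ U i ⊔ Y₂.sup U) := by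
    rw [Finset.sup_insert, Finset.sup_union, sup_sup_sup_comm, hsup]
  have hinter : (Y₁ ∩ Y₂).sup U ≤ (K ∙ v i ⊔ Y₁.sup U) ⊓ (C ⊓ U i ⊔ Y₂.sup U) :=
    le_inf ((Finset.sup_mono Finset.inter_subset_left).trans le_sup_right)
      ((Finset.sup_mono Finset.inter_subset_right).trans le_sup_right)
  have hdim := Submodule.finrank_sup_add_finrank_inf_eq
    (K ∙ v i ⊔ Y₁.sup U) (C ⊓ U i ⊔ Y₂.sup U)
  have hu := (hU _).trans (Submodule.finrank_mono hunion)
  have hn := (hU _).trans (Submodule.finrank_mono hinter)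
  rw [Finset.card_insert_of_notMem (by simp [hi₁, hi₂])] at hu
  have hcard := Finset.card_union_add_card_inter Y₁ Y₂
  omega

/-- If `∑ i ∈ X, b i ≤ dim (∑ i ∈ X, V i)` for every `X`, then there are independent subspaces
of the `V i` of dimensions `b i`. -/
theorem exists_le_finrank_eq_of_sum_le_finrank_sup {ι K W : Type*} [Fintype ι] [Field K]
    [AddCommGroup W] [Module K W] [FiniteDimensional K W] (V : ι → Submodule K W) (b : ι → ℕ)
    (hV : ∀ X : Finset ι, ∑ i ∈ X, b i ≤ Module.finrank K ↥(X.sup V)) :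
    ∃ V' : ι → Submodule K W, (∀ i, V' i ≤ V i ∧ Module.finrank K ↥(V' i) = b i) ∧
      Module.finrank K ↥(⨆ i, V' i) = ∑ i, b i := by
  obtain ⟨w, hwV, hw⟩ := exists_linearIndependent_of_card_le_finrank_sup
    (fun p : Σ i, Fin (b i) => V p.1) fun Y => by
      calc Y.card ≤ ((Y.image Sigma.fst).sigma fun i => (Finset.univ : Finset (Fin (b i)))).card :=
            Finset.card_le_card fun p hp => Finset.mem_sigma.2
              ⟨Finset.mem_image_of_mem _ hp, Finset.mem_univ _⟩
        _ = ∑ i ∈ Y.image Sigma.fst, b i := by simp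
        _ ≤ _ := hV _
        _ = _ := by rw [Finset.sup_image]; rfl
  refine ⟨fun i => Submodule.span K (Set.range fun j : Fin (b i) => w ⟨i, j⟩), fun i => ⟨?_, ?_⟩, ?_⟩
  · rw [Submodule.span_le]
    rintro _ ⟨j, rfl⟩
    exact hwV ⟨i, j⟩
  · exact (finrank_span_eq_card (hw.comp (Sigma.mk i) sigma_mk_injective)).trans (Fintype.card_fin _)
  · rw [← Submodule.span_iUnion, ← Set.range_sigma_eq_iUnion_range, finrank_span_eq_card hw]
    simp

namespace DiscretePolymatroid

theorem setSum_le_rho {r : ℕ} (D : DiscretePolymatroid r) {u : Fin r → ℕ} (hu : u ∈ D.carrier)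
    (A : Set (Fin r)) : setSum u A ≤ D.rho A :=
  Finset.le_sup (f := fun u => setSum u A) (D.finite.mem_toFinset.2 hu)

theorem sum_eq_rank_of_isBasisOf {r : ℕ} (D : DiscretePolymatroid r) {b : Fin r → ℕ}
    (hb : IsBasisOf D.carrier b) : ∑ i, b i = D.rank := by
  apply le_antisymm
  · simpa [setSum, rank] using D.setSum_le_rho hb.1 Set.univ
  · refine Finset.sup_le fun u hu => ?_
    by_contra! h
    obtain ⟨w, hw, hbw, hne, -⟩ := D.exchange b hb.1 u (D.finite.mem_toFinset.1 hu)
      (by simpa [setSum] using h)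
    exact hne (hb.2 w hw hbw).symm

end DiscretePolymatroid

/-- **Lemma 7.** If the subspaces `V_1,…,V_r` of a finite-dimensional vector space form a
representation of the discrete polymatroid `D` and `b` is a basis vector of `D`, then there
exist subspaces `V'_i ⊆ V_i`, for `i ∈ supp(b)`, with `dim V'_i = b_i` and
`dim (∑_{i ∈ supp(b)} V'_i) = rank D`. -/
theorem exists_subspaces_of_basisVec {r : ℕ} (D : DiscretePolymatroid r)
    (K : Type) [Field K] (W : Type) [AddCommGroup W] [Module K W] [FiniteDimensional K W]
    (V : Fin r → Submodule K W)
    (hV : ∀ X : Set (Fin r), Module.finrank K ↥(⨆ i ∈ X, V i) = D.rho X)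
    (b : Fin r → ℕ) (hb : IsBasisOf D.carrier b) :
    ∃ V' : Fin r → Submodule K W,
      (∀ i : Fin r, b i ≠ 0 → V' i ≤ V i ∧ Module.finrank K ↥(V' i) = b i) ∧
      Module.finrank K ↥(⨆ i ∈ {i : Fin r | b i ≠ 0}, V' i) = D.rank := by
  obtain ⟨V', hV', hsum⟩ := exists_le_finrank_eq_of_sum_le_finrank_sup V b fun X => by
    have h := D.setSum_le_rho hb.1 (X : Set (Fin r))
    rw [← hV] at h
    rw [Finset.sup_eq_iSup]
    exact (by simp [setSum] : ∑ i ∈ X, b i = setSum b X).trans_le h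
  refine ⟨V', fun i _ => hV' i, ?_⟩
  have hsupp : ⨆ i ∈ {i : Fin r | b i ≠ 0}, V' i = ⨆ i, V' i := by
    refine iSup_congr fun i => ?_
    by_cases hi : b i = 0
    · have hbot : V' i = ⊥ := Submodule.finrank_eq_zero.1 ((hV' i).2.trans hi)
      simp [hbot]
    · simp [hi]
  rw [hsupp, hsum, D.sum_eq_rank_of_isBasisOf hb]
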